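/- Let T₁,…,T_N (N ≥ 2) be unilateral pseudo-shifts on ℓ^p(ℕ) with maps f₁,…,f_N and weights ω^{(i)}, and set W^{(i)}_{m,n} = ∏_{ν=1}^n w^{(i)}_{f_i^ν(m)}. Suppose there is a strictly increasing sequence (n_k) of positive integers such that (a) |W^{(i)}_{m,n_k}| → ∞ for all i, m, and (b) for every ε > 0, K, M ∈ ℕ and every finite collection {a_j^{(i)} : 1 ≤ j ≤ M, 1 ≤ i ≤ N} of nonzero scalars, there exists k ≥ K such that for all i ≠ ℓ: |W^{(i)}_{f_i^{-n_k}(j),n_k} / W^{(ℓ)}_{f_ℓ^{-n_k}(j),n_k}| < ε whenever j ∈ f_ℓ^{n_k}([M]) ∩ f_i^{n_k}(ℕ∖[M]), and |W^{(i)}_{f_i^{-n_k}(j),n_k} / W^{(ℓ)}_{f_ℓ^{-n_k}(j),n_k} − a^{(i)}_{f_i^{-n_k}(j)} / a^{(ℓ)}_{f_ℓ^{-n_k}(j)}| < ε whenever j ∈ f_ℓ^{n_k}([M]) ∩ f_i^{n_k}([M]). Then T₁,…,T_N are d-hypercyclic. -/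

import Mathlib

open Filter Topology
open scoped ENNReal

/-- Birkhoff's transitivity criterion: a topologically transitive sequence of continuous maps from a
Baire space to a second countable space has a universal element. -/
theorem exists_dense_range_of_transitive {X Y : Type*} [TopologicalSpace X] [BaireSpace X]
    [Nonempty X] [TopologicalSpace Y] [SecondCountableTopology Y] (g : ℕ → X → Y)
    (hg : ∀ n, Continuous (g n))
    (htr : ∀ U : Set X, ∀ V : Set Y, IsOpen U → IsOpen V → U.Nonempty → V.Nonempty →
      ∃ n, ∃ x ∈ U, g n x ∈ V) :
    ∃ x, Dense (Set.range fun n => g n x) := by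
  let B := TopologicalSpace.countableBasis Y
  have : Countable B := (TopologicalSpace.countable_countableBasis Y).to_subtype
  have hd : Dense (⋂ V : B, ⋃ n, g n ⁻¹' (V : Set Y)) := by
    apply dense_iInter_of_isOpen
    · intro V
      exact isOpen_iUnion fun n =>
        (TopologicalSpace.isOpen_of_mem_countableBasis V.2).preimage (hg n)
    · intro V
      rw [dense_iff_inter_open]
      intro U hU hUne
      obtain ⟨n, x, hxU, hxV⟩ := htr U V hU
        (TopologicalSpace.isOpen_of_mem_countableBasis V.2) hUne
        (TopologicalSpace.nonempty_of_mem_countableBasis V.2)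
      exact ⟨x, hxU, Set.mem_iUnion.2 ⟨n, hxV⟩⟩
  obtain ⟨x, hx⟩ := hd.nonempty
  refine ⟨x, (TopologicalSpace.isBasis_countableBasis Y).dense_iff.2 fun V hV _ => ?_⟩
  obtain ⟨n, hn⟩ := Set.mem_iUnion.1 (Set.mem_iInter.1 hx ⟨V, hV⟩)
  exact ⟨g n x, hn, n, rfl⟩

section lpSingle

variable {α : Type*} [DecidableEq α] {p : ℝ≥0∞}

theorem lp_separableSpace [Fact (1 ≤ p)] [Countable α] (hp : p ≠ ⊤) :
    TopologicalSpace.SeparableSpace (lp (fun _ : α => ℂ) p) := by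
  have hs : TopologicalSpace.IsSeparable
      (⋃ j : α, Set.range fun c : ℂ => (lp.single p j c : lp (fun _ : α => ℂ) p)) :=
    TopologicalSpace.IsSeparable.iUnion fun j =>
      TopologicalSpace.isSeparable_range (lp.isometry_single (E := fun _ : α => ℂ) j).continuous
  have hspan := (hs.span (R := ℂ)).closure
  refine TopologicalSpace.isSeparable_univ_iff.1 (hspan.mono fun x _ => ?_)
  refine mem_closure_of_tendsto (lp.hasSum_single hp x) (Eventually.of_forall fun s => ?_)
  exact Submodule.sum_mem _ fun j _ =>
    Submodule.subset_span (Set.mem_iUnion.2 ⟨j, x j, rfl⟩)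

theorem lp_sum_single_apply (s : Finset α) (c : α → ℂ) (j : α) :
    (∑ i ∈ s, lp.single p i (c i) : lp (fun _ : α => ℂ) p) j = if j ∈ s then c j else 0 := by
  rw [lp.coeFn_sum, Finset.sum_apply]
  simp only [lp.single_apply, Finset.sum_pi_single]

theorem lp_norm_le_card_mul [Fact (1 ≤ p)] (x : lp (fun _ : α => ℂ) p) (s : Finset α) (δ : ℝ)
    (hx : ∀ j ∉ s, x j = 0) (hδ : ∀ j ∈ s, ‖x j‖ ≤ δ) : ‖x‖ ≤ s.card * δ := by
  have hsum : x = ∑ i ∈ s, lp.single p i (x i) := by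
    ext j
    rw [lp_sum_single_apply s (fun i => x i) j]
    split_ifs with h
    · rfl
    · exact hx j h
  calc ‖x‖ = ‖∑ i ∈ s, (lp.single p i (x i) : lp (fun _ : α => ℂ) p)‖ := by rw [← hsum]
    _ ≤ ∑ i ∈ s, ‖(lp.single p i (x i) : lp (fun _ : α => ℂ) p)‖ := norm_sum_le _ _
    _ ≤ ∑ _i ∈ s, δ := by
        refine Finset.sum_le_sum fun i hi => ?_
        rw [lp.norm_single (zero_lt_one.trans_le Fact.out)]
        exact hδ i hi
    _ = s.card * δ := by simp

end lpSingle

/-- The coordinates of the iterates of a pseudo-shift. -/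
theorem pseudoShift_pow_apply {p : ℝ≥0∞} [Fact (1 ≤ p)] {f : ℕ+ → ℕ+} {w : ℕ+ → ℂ}
    {T : lp (fun _ : ℕ+ => ℂ) p →L[ℂ] lp (fun _ : ℕ+ => ℂ) p}
    (hT : ∀ (x : lp (fun _ : ℕ+ => ℂ) p) (m : ℕ+), T x m = w (f m) * x (f m))
    (n : ℕ) (x : lp (fun _ : ℕ+ => ℂ) p) (m : ℕ+) :
    (T ^ n) x m = (∏ ν ∈ Finset.Icc 1 n, w (f^[ν] m)) * x (f^[n] m) := by
  induction n generalizing x with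
  | zero => simp
  | succ n ih =>
    rw [pow_succ, mul_apply_eq_comp, ih, hT, Finset.prod_Icc_succ_top (by omega),
      ← Function.iterate_succ_apply' f n m, mul_assoc]

theorem lt_iterate_of_strictMono {f : ℕ+ → ℕ+} (hf : StrictMono f) (hf1 : 1 < f 1) (n : ℕ)
    (m : ℕ+) : n < (f^[n] m : ℕ) := by
  have hlt : ∀ m, m < f m := by
    intro m
    induction m using PNat.recOn with
    | one => exact hf1
    | succ m ih =>
      exact lt_of_le_of_lt (PNat.add_one_le_iff.2 ih) (hf (PNat.lt_add_right m 1))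
  induction n with
  | zero => simp
  | succ n ih =>
    rw [Function.iterate_succ_apply']
    have := PNat.coe_lt_coe _ _ |>.2 (hlt (f^[n] m))
    omega

theorem pnat_card_Iic (M : ℕ+) : (Finset.Iic M).card = (M : ℕ) := by
  have : Finset.Iic M = Finset.Icc 1 M := by
    ext j
    simp
  rw [this, PNat.card_Icc, PNat.one_coe, Nat.add_sub_cancel]

/-- If the weight quotients `W i m' / W l m` at coinciding positions `g l m = g i m'` approximate
`a i m' / a l m` (for `m' ≤ M`) or `0` (for `m' > M`), then one small sequence supported on the
union of the images `g i [M]` is mapped close to `a i` by all weighted compositions simultaneously. -/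
theorem exists_simultaneous_approx {ι : Type*} [Fintype ι] (g : ι → ℕ+ → ℕ+)
    (hg : ∀ i, Function.Injective (g i)) (W : ι → ℕ+ → ℂ) (hW : ∀ i m, W i m ≠ 0) (M : ℕ+)
    (a : ι → ℕ+ → ℂ) (ha0 : ∀ i m, m ≤ M → a i m ≠ 0) (A δ : ℝ)
    (hA : ∀ i m, m ≤ M → ‖a i m‖ ≤ A) (hA0 : 0 ≤ A) (hδ0 : 0 ≤ δ)
    (hWδ : ∀ i m, m ≤ M → ‖W i m‖⁻¹ ≤ δ)
    (h₁ : ∀ i l, i ≠ l → ∀ m m', m ≤ M → M < m' → g l m = g i m' → ‖W i m' / W l m‖ ≤ δ)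
    (h₂ : ∀ i l, i ≠ l → ∀ m m', m ≤ M → m' ≤ M → g l m = g i m' →
      ‖W i m' / W l m - a i m' / a l m‖ ≤ δ) :
    ∃ (s : Finset ℕ+) (z : ℕ+ → ℂ), s.card ≤ Fintype.card ι * M ∧ (∀ j ∉ s, z j = 0) ∧
      (∀ j, ‖z j‖ ≤ A * δ) ∧ (∀ i m, m ≤ M → g i m ∈ s) ∧
      ∀ i m, ‖W i m * z (g i m) - (if m ≤ M then a i m else 0)‖ ≤ A * δ := by
  classical
  let P : ℕ+ → Prop := fun j => ∃ q : ι × ℕ+, q.2 ≤ M ∧ g q.1 q.2 = j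
  let z : ℕ+ → ℂ := fun j =>
    if h : P j then a h.choose.1 h.choose.2 / W h.choose.1 h.choose.2 else 0
  have hz : ∀ j, P j → ∃ l m, m ≤ M ∧ g l m = j ∧ z j = a l m / W l m := by
    intro j h
    exact ⟨h.choose.1, h.choose.2, h.choose_spec.1, h.choose_spec.2, dif_pos h⟩
  have hz0 : ∀ j, ¬ P j → z j = 0 := fun j h => dif_neg h
  have hAδ : 0 ≤ A * δ := mul_nonneg hA0 hδ0
  refine ⟨Finset.univ.biUnion fun i => (Finset.Iic M).image (g i), z, ?_, ?_, ?_, ?_, ?_⟩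
  · refine (Finset.card_biUnion_le_card_mul _ _ (M : ℕ) fun i _ => ?_).trans (by simp)
    exact Finset.card_image_le.trans (pnat_card_Iic M).le
  · intro j hj
    refine hz0 j fun ⟨q, hq, hqj⟩ => hj ?_
    simp only [Finset.mem_biUnion, Finset.mem_univ, true_and, Finset.mem_image, Finset.mem_Iic]
    exact ⟨q.1, q.2, hq, hqj⟩
  · intro j
    by_cases h : P j
    · obtain ⟨l, m, hm, -, he⟩ := hz j h
      rw [he, div_eq_mul_inv, norm_mul, norm_inv]
      exact mul_le_mul (hA l m hm) (hWδ l m hm) (by positivity) hA0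
    · simpa [hz0 j h] using hAδ
  · intro i m hm
    simp only [Finset.mem_biUnion, Finset.mem_univ, true_and, Finset.mem_image, Finset.mem_Iic]
    exact ⟨i, m, hm, rfl⟩
  · intro i m'
    by_cases h : P (g i m')
    · obtain ⟨l, m, hm, hgm, he⟩ := hz _ h
      rw [he]
      rcases eq_or_ne i l with rfl | hil
      · obtain rfl := hg i hgm
        rw [if_pos hm, mul_div_cancel₀ _ (hW i m), sub_self, norm_zero]
        exact hAδ
      · have hWl := hW l m
        have hal := ha0 l m hm
        split_ifs with hm'
        · have : W i m' * (a l m / W l m) - a i m' =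
              a l m * (W i m' / W l m - a i m' / a l m) := by
            field_simp
          rw [this, norm_mul]
          exact mul_le_mul (hA l m hm) (h₂ i l hil m m' hm hm' hgm) (norm_nonneg _) hA0
        · have : W i m' * (a l m / W l m) - 0 = a l m * (W i m' / W l m) := by
            field_simp
            ring
          rw [this, norm_mul]
          exact mul_le_mul (hA l m hm) (h₁ i l hil m m' hm (not_le.1 hm') hgm)
            (norm_nonneg _) hA0
    · have hm' : ¬ m' ≤ M := fun hm' => h ⟨(i, m'), hm', rfl⟩
      simpa [hz0 _ h, hm'] using hAδ

/-- Sufficient condition (iii) of the characterization theorem: the weight conditions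
(a) and (b) imply that the unilateral pseudo-shifts `T₁, …, T_N` are d-hypercyclic. -/
theorem stmt7 (p : ℝ≥0∞) [Fact (1 ≤ p)] (hp : p ≠ ⊤) (N : ℕ) (hN : 2 ≤ N)
    (f : Fin N → ℕ+ → ℕ+) (hf : ∀ i, StrictMono (f i)) (hf1 : ∀ i, 1 < f i 1)
    (w : Fin N → ℕ+ → ℂ) (hwb : ∀ i, ∃ C, ∀ m, ‖w i m‖ ≤ C) (hw0 : ∀ i m, w i m ≠ 0)
    (T : Fin N → (lp (fun _ : ℕ+ => ℂ) p →L[ℂ] lp (fun _ : ℕ+ => ℂ) p))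
    (hT : ∀ i (x : lp (fun _ : ℕ+ => ℂ) p) (m : ℕ+),
      (T i x : ∀ _ : ℕ+, ℂ) m = w i (f i m) * (x : ∀ _ : ℕ+, ℂ) (f i m))
    (n : ℕ → ℕ) (hmono : StrictMono n) (hpos : ∀ k, 0 < n k)
    (ha : ∀ i m, Tendsto
      (fun k => ‖∏ ν ∈ Finset.Icc 1 (n k), w i ((f i)^[ν] m)‖) atTop atTop)
    (hb : ∀ ε > (0 : ℝ), ∀ (K : ℕ) (M : ℕ+), ∀ a : Fin N → ℕ+ → ℂ,
      (∀ i j, j ≤ M → a i j ≠ 0) →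
      ∃ k ≥ K, ∀ i ℓ : Fin N, i ≠ ℓ →
        (∀ m m' : ℕ+, m ≤ M → M < m' → (f ℓ)^[n k] m = (f i)^[n k] m' →
          ‖(∏ ν ∈ Finset.Icc 1 (n k), w i ((f i)^[ν] m')) /
            (∏ ν ∈ Finset.Icc 1 (n k), w ℓ ((f ℓ)^[ν] m))‖ < ε) ∧
        (∀ m m' : ℕ+, m ≤ M → m' ≤ M → (f ℓ)^[n k] m = (f i)^[n k] m' →
          ‖(∏ ν ∈ Finset.Icc 1 (n k), w i ((f i)^[ν] m')) /
            (∏ ν ∈ Finset.Icc 1 (n k), w ℓ ((f ℓ)^[ν] m)) - a i m' / a ℓ m‖ < ε)) :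
    ∃ x : lp (fun _ : ℕ+ => ℂ) p,
      Dense (Set.range fun nn : ℕ => fun i : Fin N => (T i ^ nn) x) := by
  classical
  have hsep := lp_separableSpace (α := ℕ+) hp
  have : SecondCountableTopology (lp (fun _ : ℕ+ => ℂ) p) :=
    UniformSpace.secondCountable_of_separable _
  refine exists_dense_range_of_transitive (fun nn x => fun i : Fin N => (T i ^ nn) x)
    (fun nn => continuous_pi fun i => (T i ^ nn).continuous) ?_
  rintro U V hU hV ⟨u, hu⟩ ⟨v, hv⟩
  obtain ⟨ε₁, hε₁, hUε⟩ := Metric.isOpen_iff.1 hU u hu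
  obtain ⟨ε₂, hε₂, hVε⟩ := Metric.isOpen_iff.1 hV v hv
  obtain ⟨ε, hε, hεε₁, hεε₂⟩ : ∃ ε > 0, ε ≤ ε₁ ∧ ε ≤ ε₂ :=
    ⟨min ε₁ ε₂, lt_min hε₁ hε₂, min_le_left _ _, min_le_right _ _⟩
  suffices H : ∃ k x, ‖x - u‖ < ε ∧ ∀ i, ‖(T i ^ k) x - v i‖ < ε by
    obtain ⟨k, x, hx, hTx⟩ := H
    refine ⟨k, x, hUε ?_, hVε ?_⟩
    · rw [Metric.mem_ball, dist_eq_norm]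
      exact hx.trans_le hεε₁
    · rw [Metric.mem_ball, dist_pi_lt_iff hε₂]
      intro i
      rw [dist_eq_norm]
      exact (hTx i).trans_le hεε₂
  have htrunc : ∀ y : lp (fun _ : ℕ+ => ℂ) p, ∀ᶠ M : ℕ+ in atTop,
      ‖∑ j ∈ Finset.Iic M, lp.single p j (y j) - y‖ < ε / 3 := by
    intro y
    have := (lp.hasSum_single hp y).comp
      (tendsto_finset_Iic_atTop_atTop (α := ℕ+))
    filter_upwards [Metric.tendsto_nhds.1 this (ε / 3) (by positivity)] with M hM
    rwa [dist_eq_norm] at hM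
  obtain ⟨M, huM, hvM⟩ :=
    ((htrunc u).and (eventually_all.2 fun i => htrunc (v i))).exists
  have hcard : ((Finset.Iic M).card : ℝ) = (M : ℕ) := by rw [pnat_card_Iic]
  have hM0 : (0 : ℝ) < (M : ℕ) := by exact_mod_cast M.pos
  have hN0 : (0 : ℝ) < N := by exact_mod_cast (by omega : 0 < N)
  let η : ℝ := ε / 3 / (M : ℕ)
  have hη : 0 < η := by positivity
  let a : Fin N → ℕ+ → ℂ := fun i j => if v i j = 0 then (η : ℂ) else v i j
  have ha0 : ∀ i j, a i j ≠ 0 := by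
    intro i j
    by_cases h : v i j = 0
    · simp [a, h, hη.ne']
    · simp [a, h]
  have hav : ∀ i j, ‖a i j - v i j‖ ≤ η := by
    intro i j
    by_cases h : v i j = 0
    · simp [a, h, abs_of_pos hη]
    · simpa [a, h] using hη.le
  obtain ⟨A, hA0, hA⟩ : ∃ A > 0, ∀ i j, j ≤ M → ‖a i j‖ ≤ A := by
    refine ⟨1 + ∑ i, ∑ j ∈ Finset.Iic M, ‖a i j‖, by positivity, fun i j hj => ?_⟩
    calc ‖a i j‖ ≤ ∑ j ∈ Finset.Iic M, ‖a i j‖ :=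
          Finset.single_le_sum (f := fun j => ‖a i j‖) (fun _ _ => norm_nonneg _)
            (Finset.mem_Iic.2 hj)
      _ ≤ ∑ i, ∑ j ∈ Finset.Iic M, ‖a i j‖ :=
          Finset.single_le_sum (f := fun i => ∑ j ∈ Finset.Iic M, ‖a i j‖)
            (fun _ _ => by positivity) (Finset.mem_univ i)
      _ ≤ _ := by linarith
  let δ : ℝ := ε / 4 / (N * (M : ℕ) * A)
  have hδ : 0 < δ := by positivity
  have hδε : N * (M : ℕ) * (A * δ) = ε / 4 := by
    simp only [δ]
    field_simp
  have hlarge : ∀ᶠ k in atTop, ∀ i, ∀ m ∈ Finset.Iic M,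
      δ⁻¹ ≤ ‖∏ ν ∈ Finset.Icc 1 (n k), w i ((f i)^[ν] m)‖ :=
    eventually_all.2 fun i => (Finset.eventually_all _).2 fun m _ =>
      (ha i m).eventually_ge_atTop _
  obtain ⟨K, hK⟩ := eventually_atTop.1
    (hlarge.and (hmono.tendsto_atTop.eventually_ge_atTop (M : ℕ)))
  obtain ⟨k, hkK, hk⟩ := hb δ hδ K M a fun i j _ => ha0 i j
  obtain ⟨hkW, hkM⟩ := hK k hkK
  have hinj : ∀ i, Function.Injective (f i)^[n k] := fun i => (hf i).injective.iterate _
  obtain ⟨s, z, hs, hzs, hzδ, hgs, hzW⟩ :=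
    exists_simultaneous_approx (fun i => (f i)^[n k]) hinj
      (fun i m => ∏ ν ∈ Finset.Icc 1 (n k), w i ((f i)^[ν] m))
      (fun i m => Finset.prod_ne_zero_iff.2 fun ν _ => hw0 i _) M a (fun i m _ => ha0 i m) A δ hA
      hA0.le hδ.le (fun i m hm => inv_le_of_inv_le₀ hδ (hkW i m (Finset.mem_Iic.2 hm)))
      (fun i l hil m m' hm hm' h => ((hk i l hil).1 m m' hm hm' h).le)
      (fun i l hil m m' hm hm' h => ((hk i l hil).2 m m' hm hm' h).le)
  have hbound : ∀ (t : Finset ℕ+), t.card ≤ s.card → t.card * (A * δ) ≤ ε / 4 := by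
    intro t ht
    rw [← hδε]
    have : (t.card : ℝ) ≤ N * (M : ℕ) := by
      have := ht.trans hs
      rw [Fintype.card_fin] at this
      exact_mod_cast this
    gcongr
  let Z : lp (fun _ : ℕ+ => ℂ) p := ∑ j ∈ s, lp.single p j (z j)
  have hZ : ∀ j, Z j = z j := by
    intro j
    rw [lp_sum_single_apply]
    split_ifs with h
    · rfl
    · exact (hzs j h).symm
  let u' : lp (fun _ : ℕ+ => ℂ) p := ∑ j ∈ Finset.Iic M, lp.single p j (u j)
  refine ⟨n k, u' + Z, ?_, fun i => ?_⟩
  · have hZn : ‖Z‖ ≤ ε / 4 :=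
      (lp_norm_le_card_mul Z s (A * δ) (fun j hj => by rw [hZ, hzs j hj])
        fun j _ => by rw [hZ]; exact hzδ j).trans (hbound s le_rfl)
    calc ‖u' + Z - u‖ = ‖(u' - u) + Z‖ := by congr 1; abel
      _ ≤ ‖u' - u‖ + ‖Z‖ := norm_add_le _ _
      _ < ε := by linarith
  · let v' : lp (fun _ : ℕ+ => ℂ) p := ∑ j ∈ Finset.Iic M, lp.single p j (v i j)
    let Y : lp (fun _ : ℕ+ => ℂ) p := ∑ j ∈ Finset.Iic M, lp.single p j (a i j)
    have hYv : ‖Y - v'‖ ≤ ε / 3 := by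
      refine (lp_norm_le_card_mul (Y - v') (Finset.Iic M) η (fun j hj => ?_) fun j hj => ?_).trans ?_
      · rw [lp.coeFn_sub, Pi.sub_apply, lp_sum_single_apply, lp_sum_single_apply, if_neg hj,
          if_neg hj, sub_zero]
      · rw [lp.coeFn_sub, Pi.sub_apply, lp_sum_single_apply,
          lp_sum_single_apply (Finset.Iic M) (fun j => v i j) j, if_pos hj, if_pos hj]
        exact hav i j
      · rw [hcard, mul_div_cancel₀ _ hM0.ne']
    have hcoord : ∀ m, ((T i ^ n k) (u' + Z) - Y) m =
        (∏ ν ∈ Finset.Icc 1 (n k), w i ((f i)^[ν] m)) * z ((f i)^[n k] m) -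
          (if m ≤ M then a i m else 0) := by
      intro m
      have hu' : u' ((f i)^[n k] m) = 0 := by
        rw [lp_sum_single_apply (Finset.Iic M) (fun j => u j), if_neg]
        rw [Finset.mem_Iic, not_le, ← PNat.coe_lt_coe]
        exact hkM.trans_lt (lt_iterate_of_strictMono (hf i) (hf1 i) (n k) m)
      rw [lp.coeFn_sub, Pi.sub_apply, pseudoShift_pow_apply (hT i), lp.coeFn_add, Pi.add_apply,
        hu', hZ, zero_add, lp_sum_single_apply]
      simp only [Finset.mem_Iic]
    have hTY : ‖(T i ^ n k) (u' + Z) - Y‖ ≤ ε / 4 := by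
      refine (lp_norm_le_card_mul _ (s.preimage _ (hinj i).injOn) (A * δ) (fun m hm => ?_)
        fun m _ => ?_).trans (hbound _ ?_)
      · rw [Finset.mem_preimage] at hm
        rw [hcoord, hzs _ hm, if_neg fun h => hm (hgs i m h), mul_zero, sub_zero]
      · rw [hcoord]
        exact hzW i m
      · exact Finset.card_le_card_of_injOn _ (fun m hm => Finset.mem_preimage.1 hm) (hinj i).injOn
    calc ‖(T i ^ n k) (u' + Z) - v i‖
        = ‖((T i ^ n k) (u' + Z) - Y) + (Y - v') + (v' - v i)‖ := by congr 1; abel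
      _ ≤ ‖(T i ^ n k) (u' + Z) - Y‖ + ‖Y - v'‖ + ‖v' - v i‖ := norm_add₃_le
      _ < ε := by linarith [hvM i]
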